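/- arXiv:2109.07042 — 5 statements merged into one kernel-verified Lean document; each statement's English description precedes it below -/
import Mathlib

section
/- There exists a constant C > 0 such that for all t ≥ 1 and all η ∈ ℝ, ∫₀^∞ e^{−4 t q²} |q − η|^{−1/2} dq ≤ C t^{−1/4}. -/
open MeasureTheory

/-- The inverse square root, cut off beyond `s`. -/
noncomputable def truncatedInvSqrt (s : ℝ) : ℝ → ℝ :=
  (Set.Iic s).indicator fun x => x ^ (-(1 / 2) : ℝ)

lemma integral_Ioi_truncatedInvSqrt {s : ℝ} (hs : 0 < s) :
    ∫ x in Set.Ioi 0, truncatedInvSqrt s x = 2 * s ^ (1 / 2 : ℝ) := by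
  rw [truncatedInvSqrt, integral_indicator measurableSet_Iic,
    Measure.restrict_restrict measurableSet_Iic, Set.Iic_inter_Ioi,
    ← intervalIntegral.integral_of_le hs.le, integral_rpow (Or.inl (by norm_num))]
  norm_num
  ring

lemma integral_truncatedInvSqrt_abs_sub {s : ℝ} (hs : 0 < s) (η : ℝ) :
    ∫ q, truncatedInvSqrt s |q - η| = 4 * s ^ (1 / 2 : ℝ) := by
  rw [integral_sub_right_eq_self (fun q => truncatedInvSqrt s |q|) η, integral_comp_abs,
    integral_Ioi_truncatedInvSqrt hs]
  ring

lemma integrable_truncatedInvSqrt_abs_sub {s : ℝ} (hs : 0 < s) (η : ℝ) :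
    Integrable fun q => truncatedInvSqrt s |q - η| := by
  refine .of_integral_ne_zero ?_
  rw [integral_truncatedInvSqrt_abs_sub hs]
  positivity

lemma mul_abs_rpow_le_truncatedInvSqrt_add {s a x : ℝ} (hs : 0 < s) (ha : 0 ≤ a) (ha' : a ≤ 1) :
    a * |x| ^ (-(1 / 2) : ℝ) ≤ truncatedInvSqrt s |x| + s ^ (-(1 / 2) : ℝ) * a := by
  by_cases h : |x| ≤ s
  · rw [truncatedInvSqrt, Set.indicator_of_mem (Set.mem_Iic.2 h)]
    have hx : 0 ≤ |x| ^ (-(1 / 2) : ℝ) := by positivity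
    have hsa : 0 ≤ s ^ (-(1 / 2) : ℝ) * a := by positivity
    nlinarith
  · rw [truncatedInvSqrt, Set.indicator_of_notMem (by simpa using h), zero_add, mul_comm]
    exact mul_le_mul_of_nonneg_right
      (Real.rpow_le_rpow_of_nonpos hs (not_le.1 h).le (by norm_num)) ha

/-- Uniform Gaussian-singular integral bound: there is `C > 0` such that for all `t ≥ 1`
and all `η ∈ ℝ`, `∫₀^∞ e^{−4tq²} |q−η|^{−1/2} dq ≤ C t^{−1/4}`. -/
theorem gaussian_singular_bound :
    ∃ C : ℝ, 0 < C ∧ ∀ t : ℝ, 1 ≤ t → ∀ η : ℝ,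
      (∫ q in Set.Ioi (0 : ℝ),
          Real.exp (-4 * t * q ^ 2) * |q - η| ^ (-(1 / 2) : ℝ)) ≤
        C * t ^ (-(1 / 4) : ℝ) := by
  refine ⟨4 + √(Real.pi / 4), by positivity, fun t ht η => ?_⟩
  have ht0 : 0 < t := by linarith
  set s : ℝ := t ^ (-(1 / 2) : ℝ) with hs_def
  have hs : 0 < s := by positivity
  have hsing := integrable_truncatedInvSqrt_abs_sub hs η
  have hgauss : Integrable fun q : ℝ => s ^ (-(1 / 2) : ℝ) * Real.exp (-(4 * t) * q ^ 2) :=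
    (integrable_exp_neg_mul_sq (by positivity)).const_mul _
  have hbound (q : ℝ) : Real.exp (-4 * t * q ^ 2) * |q - η| ^ (-(1 / 2) : ℝ) ≤
      truncatedInvSqrt s |q - η| + s ^ (-(1 / 2) : ℝ) * Real.exp (-(4 * t) * q ^ 2) := by
    rw [← neg_mul 4 t]
    refine mul_abs_rpow_le_truncatedInvSqrt_add hs (Real.exp_pos _).le (Real.exp_le_one_iff.2 ?_)
    nlinarith [mul_nonneg ht0.le (sq_nonneg q)]
  have hnonneg (q : ℝ) : 0 ≤ Real.exp (-4 * t * q ^ 2) * |q - η| ^ (-(1 / 2) : ℝ) := by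
    positivity
  have hs_sqrt : s ^ (1 / 2 : ℝ) = t ^ (-(1 / 4) : ℝ) := by
    rw [hs_def, ← Real.rpow_mul ht0.le]
    norm_num
  have hs_inv : s ^ (-(1 / 2) : ℝ) * √(Real.pi / (4 * t)) =
      √(Real.pi / 4) * t ^ (-(1 / 4) : ℝ) := by
    rw [← div_div, Real.sqrt_div (by positivity), hs_def, ← Real.rpow_mul ht0.le,
      Real.sqrt_eq_rpow t, div_eq_mul_inv _ (t ^ _), ← Real.rpow_neg ht0.le, mul_left_comm,
      ← Real.rpow_add ht0]
    norm_num
  calc _ ≤ ∫ q in Set.Ioi (0 : ℝ), (truncatedInvSqrt s |q - η| +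
          s ^ (-(1 / 2) : ℝ) * Real.exp (-(4 * t) * q ^ 2)) :=
        integral_mono_of_nonneg (.of_forall hnonneg) (hsing.add hgauss).integrableOn
          (.of_forall hbound)
    _ ≤ ∫ q, (truncatedInvSqrt s |q - η| +
          s ^ (-(1 / 2) : ℝ) * Real.exp (-(4 * t) * q ^ 2)) :=
        setIntegral_le_integral (hsing.add hgauss)
          (.of_forall fun q => (hnonneg q).trans (hbound q))
    _ = (4 + √(Real.pi / 4)) * t ^ (-(1 / 4) : ℝ) := by
        rw [integral_add hsing hgauss, integral_truncatedInvSqrt_abs_sub hs, integral_const_mul,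
          integral_gaussian, hs_inv, hs_sqrt]
        ring
end

section
/- Let a, b ∈ [0,1) with a + b < 1. Then there exists a constant C = C(a,b) > 0 such that for all t ≥ 1 and all η ∈ ℝ, ∫₀^∞ e^{−t q²} q^{−a} |q − η|^{−b} dq ≤ C t^{(a+b−1)/2}. In particular, when a + b ≤ 1/2 the integral is O(t^{−1/4}) uniformly in η. -/
open MeasureTheory

/-- The truncated power `u ↦ |u| ^ (-c)` on `[-r, r]`, written as a sum of its two halves. -/
noncomputable def truncatedPower (c r u : ℝ) : ℝ :=
  (Set.Icc 0 r).indicator (fun x => x ^ (-c)) u + (Set.Icc 0 r).indicator (fun x => x ^ (-c)) (-u)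

lemma indicator_rpow_nonneg (c r u : ℝ) :
    0 ≤ (Set.Icc 0 r).indicator (fun x => x ^ (-c)) u :=
  Set.indicator_nonneg (fun _ hx => Real.rpow_nonneg hx.1 _) u

lemma truncatedPower_nonneg (c r u : ℝ) : 0 ≤ truncatedPower c r u :=
  add_nonneg (indicator_rpow_nonneg c r u) (indicator_rpow_nonneg c r (-u))

lemma abs_rpow_le_truncatedPower {c r u : ℝ} (hu : |u| ≤ r) :
    |u| ^ (-c) ≤ truncatedPower c r u := by
  unfold truncatedPower
  rcases le_total 0 u with h | h
  · rw [abs_of_nonneg h] at hu ⊢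
    rw [Set.indicator_of_mem (Set.mem_Icc.2 ⟨h, hu⟩)]
    exact le_add_of_nonneg_right (indicator_rpow_nonneg c r (-u))
  · rw [abs_of_nonpos h] at hu ⊢
    rw [Set.indicator_of_mem (a := -u) (Set.mem_Icc.2 ⟨neg_nonneg.2 h, hu⟩)]
    exact le_add_of_nonneg_left (indicator_rpow_nonneg c r u)

lemma integrable_indicator_rpow {c r : ℝ} (hc : c < 1) (hr : 0 ≤ r) :
    Integrable ((Set.Icc 0 r).indicator (fun x : ℝ => x ^ (-c))) := by
  rw [integrable_indicator_iff measurableSet_Icc, integrableOn_Icc_iff_integrableOn_Ioc,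
    ← intervalIntegrable_iff_integrableOn_Ioc_of_le hr]
  exact intervalIntegral.intervalIntegrable_rpow' (by linarith)

lemma integrable_truncatedPower {c r : ℝ} (hc : c < 1) (hr : 0 ≤ r) :
    Integrable (truncatedPower c r) :=
  (integrable_indicator_rpow hc hr).add (integrable_indicator_rpow hc hr).comp_neg

lemma integral_truncatedPower {c r : ℝ} (hc : c < 1) (hr : 0 ≤ r) :
    ∫ u, truncatedPower c r u = 2 / (1 - c) * r ^ (1 - c) := by
  have half : ∫ u, (Set.Icc 0 r).indicator (fun x : ℝ => x ^ (-c)) u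
      = r ^ (1 - c) / (1 - c) := by
    rw [integral_indicator measurableSet_Icc, integral_Icc_eq_integral_Ioc,
      ← intervalIntegral.integral_of_le hr, integral_rpow (Or.inl (by linarith)),
      show -c + 1 = 1 - c by ring, Real.zero_rpow (by linarith), sub_zero]
  unfold truncatedPower
  rw [integral_add (integrable_indicator_rpow hc hr) (integrable_indicator_rpow hc hr).comp_neg,
    integral_neg_eq_self ((Set.Icc 0 r).indicator (fun x : ℝ => x ^ (-c))) volume, half]
  ring

/-- The product of two singularities is dominated by the sum of the two singularities of
the combined order. -/
lemma rpow_neg_mul_rpow_neg_le {a b x y : ℝ} (ha : 0 ≤ a) (hb : 0 ≤ b) (hx : 0 < x)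
    (hy : 0 ≤ y) :
    x ^ (-a) * y ^ (-b) ≤ x ^ (-(a + b)) + y ^ (-(a + b)) := by
  have hx' := Real.rpow_nonneg hx.le (-(a + b))
  have hy' := Real.rpow_nonneg hy (-(a + b))
  rcases le_total x y with h | h
  · calc x ^ (-a) * y ^ (-b) ≤ x ^ (-a) * x ^ (-b) :=
          mul_le_mul_of_nonneg_left (Real.rpow_le_rpow_of_nonpos hx h (by linarith))
            (Real.rpow_nonneg hx.le _)
      _ = x ^ (-(a + b)) := by rw [← Real.rpow_add hx]; ring_nf
      _ ≤ _ := by linarith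
  · rcases hy.eq_or_lt with rfl | hy0
    · rcases hb.eq_or_lt with rfl | hb0
      · simpa using hy'
      · rw [Real.zero_rpow (by linarith : -b ≠ 0), mul_zero]
        positivity
    · calc x ^ (-a) * y ^ (-b) ≤ y ^ (-a) * y ^ (-b) :=
          mul_le_mul_of_nonneg_right (Real.rpow_le_rpow_of_nonpos hy0 h (by linarith))
            (Real.rpow_nonneg hy _)
        _ = y ^ (-(a + b)) := by rw [← Real.rpow_add hy0]; ring_nf
        _ ≤ _ := by linarith

/-- A singularity damped by a factor `e ≤ 1` splits into a part within distance `r` of it and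
a part where the power is at most `r ^ (-c)`. -/
lemma mul_abs_rpow_le {c r e u : ℝ} (hc : 0 ≤ c) (hr : 0 < r) (he0 : 0 ≤ e) (he1 : e ≤ 1) :
    e * |u| ^ (-c) ≤ truncatedPower c r u + r ^ (-c) * e := by
  rcases le_total |u| r with h | h
  · have h1 := abs_rpow_le_truncatedPower (c := c) h
    have h2 : e * |u| ^ (-c) ≤ |u| ^ (-c) :=
      mul_le_of_le_one_left (Real.rpow_nonneg (abs_nonneg u) _) he1
    have h3 : 0 ≤ r ^ (-c) * e := by positivity
    linarith
  · have h1 : |u| ^ (-c) ≤ r ^ (-c) := Real.rpow_le_rpow_of_nonpos hr h (by linarith)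
    have h2 := mul_le_mul_of_nonneg_left h1 he0
    have h3 := truncatedPower_nonneg c r u
    linarith

/-- Uniform estimate for a Gaussian integral with two power singularities: if
`a, b ∈ [0,1)` with `a + b < 1`, then there is `C > 0` such that for all `t ≥ 1` and `η ∈ ℝ`,
`∫₀^∞ e^{−tq²} q^{−a} |q−η|^{−b} dq ≤ C t^{(a+b−1)/2}`. -/
theorem gaussian_two_singularities_bound (a b : ℝ)
    (ha0 : 0 ≤ a) (ha1 : a < 1) (hb0 : 0 ≤ b) (hb1 : b < 1) (hab : a + b < 1) :
    ∃ C : ℝ, 0 < C ∧ ∀ t : ℝ, 1 ≤ t → ∀ η : ℝ,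
      (∫ q in Set.Ioi (0 : ℝ),
          Real.exp (-t * q ^ 2) * q ^ (-a) * |q - η| ^ (-b)) ≤
        C * t ^ ((a + b - 1) / 2) := by
  have hc : 0 < 1 - (a + b) := by linarith
  refine ⟨4 / (1 - (a + b)) + 2 * √Real.pi, by positivity, fun t ht η => ?_⟩
  have ht0 : 0 < t := by linarith
  set c := a + b with hcdef
  have hc0 : 0 ≤ c := add_nonneg ha0 hb0
  set r : ℝ := t ^ (-(1 / 2) : ℝ) with hrdef
  have hr : 0 < r := Real.rpow_pos_of_pos ht0 _
  have int_k := integrable_truncatedPower hab hr.le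
  have int_kη := int_k.comp_sub_right η
  have int_g := (integrable_exp_neg_mul_sq ht0).const_mul (2 * r ^ (-c))
  have int_kk : Integrable fun q => truncatedPower c r q + truncatedPower c r (q - η) :=
    int_k.add int_kη
  have int_G := int_kk.add int_g
  have hsqrt : √(Real.pi / t) = √Real.pi * r := by
    rw [Real.sqrt_div Real.pi_pos.le, hrdef, Real.rpow_neg ht0.le, ← Real.sqrt_eq_rpow,
      div_eq_mul_inv]
  have hrc : r ^ (1 - c) = t ^ ((c - 1) / 2) := by
    rw [hrdef, ← Real.rpow_mul ht0.le]
    ring_nf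
  have hrr : r ^ (-c) * r = r ^ (1 - c) := by
    rw [← Real.rpow_add_one hr.ne']
    ring_nf
  calc (∫ q in Set.Ioi (0 : ℝ), Real.exp (-t * q ^ 2) * q ^ (-a) * |q - η| ^ (-b))
      ≤ ∫ q in Set.Ioi (0 : ℝ), (truncatedPower c r q + truncatedPower c r (q - η)
          + 2 * r ^ (-c) * Real.exp (-t * q ^ 2)) := by
        refine integral_mono_of_nonneg ?_ int_G.integrableOn ?_
        · filter_upwards [ae_restrict_mem measurableSet_Ioi] with q hq
          have hq0 : 0 < q := hq
          show 0 ≤ _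
          positivity
        · filter_upwards [ae_restrict_mem measurableSet_Ioi] with q hq
          have hq0 : 0 < q := hq
          have he0 := (Real.exp_pos (-t * q ^ 2)).le
          have he1 : Real.exp (-t * q ^ 2) ≤ 1 := Real.exp_le_one_iff.2 (by nlinarith [sq_nonneg q])
          have h1 := mul_le_mul_of_nonneg_left
            (rpow_neg_mul_rpow_neg_le ha0 hb0 hq0 (abs_nonneg (q - η))) he0
          have h2 := mul_abs_rpow_le (u := q) hc0 hr he0 he1
          have h3 := mul_abs_rpow_le (u := q - η) hc0 hr he0 he1
          rw [abs_of_pos hq0] at h2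
          rw [← hcdef] at h1
          linarith
    _ ≤ ∫ q, (truncatedPower c r q + truncatedPower c r (q - η)
          + 2 * r ^ (-c) * Real.exp (-t * q ^ 2)) := by
        refine setIntegral_le_integral int_G (Filter.Eventually.of_forall fun q => ?_)
        have h1 := truncatedPower_nonneg c r q
        have h2 := truncatedPower_nonneg c r (q - η)
        show 0 ≤ _
        positivity
    _ = 2 * (2 / (1 - c) * r ^ (1 - c)) + 2 * r ^ (-c) * (√Real.pi * r) := by
        rw [integral_add int_kk int_g, integral_add int_k int_kη,
          integral_sub_right_eq_self (truncatedPower c r) η, integral_const_mul,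
          integral_gaussian, hsqrt, integral_truncatedPower hab hr.le]
        ring
    _ = (4 / (1 - c) + 2 * √Real.pi) * t ^ ((c - 1) / 2) := by
        rw [← hrc]
        linear_combination 2 * √Real.pi * hrr
end

section
/- Let z₀ ∈ ℝ and let ν : ℝ → ℝ be integrable, and define δ(z) = exp( i ∫_{−∞}^{z₀} ν(s)/(s − z) ds ) for Im z ≠ 0. Then lim_{b → +∞} (i b) ( δ(i b) − 1 ) = −i ∫_{−∞}^{z₀} ν(s) ds; that is, along the imaginary axis δ(z) = 1 − (i/z) ∫_{−∞}^{z₀} ν(s) ds + o(1/|z|) as z = ib → ∞. -/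
open Complex MeasureTheory Filter

/-- On the imaginary axis, `z` times the Cauchy transform of an integrable function tends to
minus its integral. -/
theorem tendsto_mul_cauchyTransform_imaginary_axis {μ : Measure ℝ} {f : ℝ → ℂ}
    (hf : Integrable f μ) :
    Tendsto (fun b : ℝ => (I * (b : ℂ)) * ∫ s, f s / ((s : ℂ) - I * (b : ℂ)) ∂μ) atTop
      (nhds (-∫ s, f s ∂μ)) := by
  simp_rw [← integral_const_mul, ← integral_neg]
  refine tendsto_integral_filter_of_dominated_convergence (fun s => ‖f s‖) ?_ ?_ hf.norm ?_
  · refine Eventually.of_forall fun b => ?_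
    have hm : Measurable fun s : ℝ => (s : ℂ) - I * (b : ℂ) := by fun_prop
    exact (hf.aestronglyMeasurable.div₀ hm.aestronglyMeasurable).const_mul _
  · filter_upwards [eventually_gt_atTop 0] with b hb
    refine Eventually.of_forall fun s => ?_
    have hle : ‖I * (b : ℂ)‖ ≤ ‖(s : ℂ) - I * (b : ℂ)‖ := by
      have h := abs_im_le_norm ((s : ℂ) - I * (b : ℂ))
      simpa using h
    have hpos : 0 < ‖I * (b : ℂ)‖ := by simpa using hb.ne'
    rw [norm_mul, norm_div, mul_div_assoc', div_le_iff₀ (hpos.trans_le hle), mul_comm]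
    gcongr
  · refine Eventually.of_forall fun s => ?_
    have hinv : Tendsto (fun b : ℝ => ((b⁻¹ : ℝ) : ℂ)) atTop (nhds 0) := by
      simpa [Function.comp_def] using (continuous_ofReal.tendsto 0).comp tendsto_inv_atTop_zero
    have hlim : Tendsto (fun b : ℝ => I * f s / ((s : ℂ) * ((b⁻¹ : ℝ) : ℂ) - I)) atTop
        (nhds (I * f s / ((s : ℂ) * 0 - I))) :=
      tendsto_const_nhds.div ((hinv.const_mul _).sub_const _) (by simp)
    have hval : I * f s / ((s : ℂ) * 0 - I) = -f s := by
      rw [mul_zero, zero_sub, div_neg, mul_div_cancel_left₀ _ I_ne_zero]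
    rw [hval] at hlim
    refine hlim.congr' ?_
    filter_upwards [eventually_gt_atTop 0] with b hb
    have hb' : (b : ℂ) ≠ 0 := ofReal_ne_zero.2 hb.ne'
    have hden : (s : ℂ) - I * (b : ℂ) = ((s : ℂ) * ((b⁻¹ : ℝ) : ℂ) - I) * b := by
      rw [ofReal_inv, sub_mul, inv_mul_cancel_right₀ hb']
    rw [hden, mul_div_assoc', mul_right_comm, mul_div_mul_right _ _ hb']

/-- If `w → 0` and `z * w → L`, then `z * (exp w - 1) → L`. -/
theorem tendsto_mul_exp_sub_one {α : Type*} {l : Filter α} {z w : α → ℂ} {L : ℂ}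
    (hw : Tendsto w l (nhds 0)) (hzw : Tendsto (fun a => z a * w a) l (nhds L)) :
    Tendsto (fun a => z a * (exp (w a) - 1)) l (nhds L) := by
  have hd : Tendsto (dslope exp 0) (nhds 0) (nhds 1) := by
    have h := (continuousAt_dslope_same.2 (differentiable_exp (0 : ℂ))).tendsto
    simpa [dslope_same] using h
  have h := hzw.mul (hd.comp hw)
  rw [mul_one] at h
  refine h.congr fun a => ?_
  have hs := sub_smul_dslope exp 0 (w a)
  rw [sub_zero, smul_eq_mul, exp_zero] at hs
  rw [Function.comp_apply, mul_assoc, hs]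

/-- Large-`z` asymptotics of the scalar conjugating factor along the imaginary axis:
`lim_{b→∞} (ib)(δ(ib) − 1) = −i ∫_{−∞}^{z₀} ν(s) ds`, i.e.
`δ(z) = 1 − (i/z)∫_{−∞}^{z₀} ν + o(1/|z|)` as `z = ib → ∞`. -/
theorem delta_large_z_asymptotics (z₀ : ℝ) (ν : ℝ → ℝ) (hν : Integrable ν)
    (δ : ℂ → ℂ)
    (hδ : ∀ z : ℂ, z.im ≠ 0 →
      δ z = Complex.exp (Complex.I * ∫ s in Set.Iio z₀, (ν s : ℂ) / ((s : ℂ) - z))) :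
    Tendsto (fun b : ℝ => (Complex.I * (b : ℂ)) * (δ (Complex.I * (b : ℂ)) - 1))
      atTop
      (nhds (-Complex.I * ((∫ s in Set.Iio z₀, ν s : ℝ) : ℂ))) := by
  have hC := tendsto_mul_cauchyTransform_imaginary_axis
    ((hν.restrict (s := Set.Iio z₀)).ofReal (𝕜 := ℂ))
  have hinv : Tendsto (fun b : ℝ => (I * (b : ℂ))⁻¹) atTop (nhds 0) := by
    refine tendsto_inv₀_cobounded.comp (tendsto_norm_atTop_iff_cobounded.1 ?_)
    simpa using tendsto_abs_atTop_atTop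
  have hzw : Tendsto (fun b : ℝ => (I * (b : ℂ)) *
      (I * ∫ s in Set.Iio z₀, (ν s : ℂ) / ((s : ℂ) - I * (b : ℂ)))) atTop
      (nhds (-I * ((∫ s in Set.Iio z₀, ν s : ℝ) : ℂ))) := by
    rw [← integral_complex_ofReal, neg_mul, ← mul_neg]
    exact (hC.const_mul I).congr fun b => mul_left_comm _ _ _
  have hne : ∀ᶠ b : ℝ in atTop, b ≠ 0 := eventually_ne_atTop 0
  have hw : Tendsto (fun b : ℝ =>
      I * ∫ s in Set.Iio z₀, (ν s : ℂ) / ((s : ℂ) - I * (b : ℂ))) atTop (nhds 0) := by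
    have h := hinv.mul hzw
    rw [zero_mul] at h
    refine h.congr' (hne.mono fun b hb => ?_)
    exact inv_mul_cancel_left₀ (mul_ne_zero I_ne_zero (ofReal_ne_zero.2 hb)) _
  refine (tendsto_mul_exp_sub_one hw hzw).congr' (hne.mono fun b hb => ?_)
  simp only [hδ (I * (b : ℂ)) (by simpa using hb)]
end

section
/- Let g : ℝ → [0, ∞) be integrable with ∫_ℝ g = G, and let K : ℝ × ℝ → ℂ be continuous with |K(x,y)| ≤ g(y) whenever x ≤ y and K(x,y) = 0 for y < x. Then for every bounded continuous f : ℝ → ℂ there exists a unique bounded continuous μ : ℝ → ℂ solving the Volterra integral equation μ(x) = f(x) + ∫_x^∞ K(x,y) μ(y) dy for all x ∈ ℝ, and it satisfies sup_x |μ(x)| ≤ e^{G} · sup_x |f(x)|. -/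
open Complex MeasureTheory

open Set Filter Topology BoundedContinuousFunction

/-- The tail integral `x ↦ ∫_x^∞ g` as a primitive. -/
lemma integral_Ioi_eq_sub_intervalIntegral {g : ℝ → ℝ} (hg : Integrable g) :
    (fun x ↦ ∫ y in Ioi x, g y) =
      fun x ↦ (∫ y in Ioi 0, g y) - ∫ y in (0 : ℝ)..x, g y := by
  funext x
  rw [← intervalIntegral.integral_Ioi_sub_Ioi' hg.integrableOn hg.integrableOn]
  ring

lemma continuous_integral_Ioi {g : ℝ → ℝ} (hg : Integrable g) :
    Continuous fun x ↦ ∫ y in Ioi x, g y := by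
  rw [integral_Ioi_eq_sub_intervalIntegral hg]
  exact continuous_const.sub (intervalIntegral.continuous_primitive
    (fun _ _ ↦ hg.intervalIntegrable) 0)

lemma antitone_integral_Ioi {g : ℝ → ℝ} (hg0 : ∀ y, 0 ≤ g y) (hg : Integrable g) :
    Antitone fun x ↦ ∫ y in Ioi x, g y := fun _ _ h ↦
  setIntegral_mono_set hg.integrableOn (ae_of_all _ hg0) (Ioi_subset_Ioi h).eventuallyLE

lemma integral_Ioi_nonneg {g : ℝ → ℝ} (hg0 : ∀ y, 0 ≤ g y) (x : ℝ) :
    0 ≤ ∫ y in Ioi x, g y :=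
  integral_nonneg hg0

lemma integral_Ioi_le_integral {g : ℝ → ℝ} (hg0 : ∀ y, 0 ≤ g y) (hg : Integrable g) (x : ℝ) :
    ∫ y in Ioi x, g y ≤ ∫ y, g y :=
  setIntegral_le_integral hg (ae_of_all _ hg0)

lemma integrable_mul_exp_integral_Ioi {g : ℝ → ℝ} (hg0 : ∀ y, 0 ≤ g y) (hg : Integrable g) :
    Integrable fun y ↦ g y * Real.exp (∫ t in Ioi y, g t) := by
  refine hg.mul_bdd (c := Real.exp (∫ y, g y))
    (Real.continuous_exp.comp (continuous_integral_Ioi hg)).aestronglyMeasurable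
    (ae_of_all _ fun y ↦ ?_)
  rw [Real.norm_of_nonneg (Real.exp_nonneg _)]
  exact Real.exp_le_exp.2 (integral_Ioi_le_integral hg0 hg y)

/-- The exponential of the tail integral of `g` is a supersolution of the Volterra equation with
kernel `g` and right-hand side `1`. -/
lemma integral_Ioi_mul_exp_integral_Ioi_le {g : ℝ → ℝ} (hg0 : ∀ y, 0 ≤ g y)
    (hg : Integrable g) (x : ℝ) :
    ∫ y in Ioi x, g y * Real.exp (∫ t in Ioi y, g t) ≤ Real.exp (∫ t in Ioi x, g t) - 1 := by
  set h : ℝ → ℝ := fun x ↦ ∫ y in Ioi x, g y with hh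
  have hint : Integrable fun y ↦ g y * Real.exp (h y) :=
    integrable_mul_exp_integral_Ioi hg0 hg
  have hmono : Monotone fun y ↦ -Real.exp (h y) := fun a b hab ↦
    neg_le_neg (Real.exp_le_exp.2 (antitone_integral_Ioi hg0 hg hab))
  have hderiv : ∀ᵐ y, deriv (fun y ↦ -Real.exp (h y)) y = g y * Real.exp (h y) := by
    filter_upwards [LocallyIntegrable.ae_hasDerivAt_integral hg.locallyIntegrable] with y hy
    have hhy : HasDerivAt h (-g y) y := by
      rw [hh, integral_Ioi_eq_sub_intervalIntegral hg]
      exact (hy 0).const_sub _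
    rw [hhy.exp.fun_neg.deriv]
    ring
  refine le_of_tendsto (intervalIntegral_tendsto_integral_Ioi x hint.integrableOn tendsto_id) ?_
  filter_upwards [eventually_ge_atTop x] with b hb
  have hmem := (hmono.monotoneOn (uIcc x b)).intervalIntegral_deriv_mem_uIcc
  rw [uIcc_of_le (sub_nonneg.2 (hmono hb)),
    intervalIntegral.integral_congr_ae (hderiv.mono fun y hy _ ↦ hy)] at hmem
  have hone : 1 ≤ Real.exp (h b) := Real.one_le_exp (integral_Ioi_nonneg hg0 b)
  have hle := hmem.2
  simp only [id]
  linarith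

section Volterra

variable {g : ℝ → ℝ} {K : ℝ → ℝ → ℂ}

lemma integrableOn_volterra_integrand (hg : Integrable g)
    (hKcont : Continuous (Function.uncurry K)) (hKb : ∀ x y : ℝ, x ≤ y → ‖K x y‖ ≤ g y)
    {w : ℝ → ℂ} (hw : Continuous w) {B : ℝ} (hB : ∀ x, ‖w x‖ ≤ B) (x : ℝ) :
    IntegrableOn (fun y ↦ K x y * w y) (Ioi x) := by
  refine (Integrable.mono' hg.integrableOn ?_ ?_).mul_bdd hw.aestronglyMeasurable
    (ae_of_all _ hB)
  · exact (hKcont.comp (Continuous.prodMk_right x)).aestronglyMeasurable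
  · exact (ae_restrict_iff' measurableSet_Ioi).2 (ae_of_all _ fun y hy ↦ hKb x y (le_of_lt hy))

lemma continuous_volterra_integral (hg0 : ∀ y, 0 ≤ g y) (hg : Integrable g)
    (hKcont : Continuous (Function.uncurry K)) (hKb : ∀ x y : ℝ, x ≤ y → ‖K x y‖ ≤ g y)
    (hK0 : ∀ x y : ℝ, y < x → K x y = 0)
    {w : ℝ → ℂ} (hw : Continuous w) {B : ℝ} (hB : ∀ x, ‖w x‖ ≤ B) :
    Continuous fun x ↦ ∫ y in Ioi x, K x y * w y := by
  have hwhole : ∀ x, ∫ y in Ioi x, K x y * w y = ∫ y, K x y * w y := fun x ↦ by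
    rw [← integral_Ici_eq_integral_Ioi]
    refine setIntegral_eq_integral_of_forall_compl_eq_zero fun y hy ↦ ?_
    rw [hK0 x y (not_le.1 hy), zero_mul]
  have hKg : ∀ x y, ‖K x y‖ ≤ g y := fun x y ↦ by
    rcases le_or_gt x y with hxy | hxy
    · exact hKb x y hxy
    · simpa [hK0 x y hxy] using hg0 y
  simp_rw [hwhole]
  refine continuous_of_dominated (bound := fun y ↦ g y * B) (fun x ↦ ?_) (fun x ↦ ?_)
    (hg.mul_const B) (ae_of_all _ fun y ↦ ?_)
  · exact ((hKcont.comp (Continuous.prodMk_right x)).mul hw).aestronglyMeasurable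
  · refine ae_of_all _ fun y ↦ ?_
    rw [norm_mul]
    exact mul_le_mul (hKg x y) (hB y) (norm_nonneg _) (hg0 y)
  · exact (hKcont.comp (Continuous.prodMk_left y)).mul continuous_const

/-- The Volterra operator is bounded in the norm weighted by the exponential of the tail of `g`. -/
lemma norm_volterra_integral_le (hg0 : ∀ y, 0 ≤ g y) (hg : Integrable g)
    (hKb : ∀ x y : ℝ, x ≤ y → ‖K x y‖ ≤ g y)
    {w : ℝ → ℂ} {c : ℝ} (hc : 0 ≤ c)
    (hw : ∀ x, ‖w x‖ ≤ c * Real.exp (∫ t in Ioi x, g t)) (x : ℝ) :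
    ‖∫ y in Ioi x, K x y * w y‖ ≤ c * (Real.exp (∫ t in Ioi x, g t) - 1) := by
  calc ‖∫ y in Ioi x, K x y * w y‖
      ≤ ∫ y in Ioi x, c * (g y * Real.exp (∫ t in Ioi y, g t)) := by
        refine norm_integral_le_of_norm_le
          ((integrable_mul_exp_integral_Ioi hg0 hg).const_mul c).integrableOn
          ((ae_restrict_iff' measurableSet_Ioi).2 (ae_of_all _ fun y hy ↦ ?_))
        rw [norm_mul, mul_left_comm]
        exact mul_le_mul (hKb x y (le_of_lt hy)) (hw y) (norm_nonneg _) (hg0 y)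
    _ = c * ∫ y in Ioi x, g y * Real.exp (∫ t in Ioi y, g t) := integral_const_mul _ _
    _ ≤ _ := mul_le_mul_of_nonneg_left (integral_Ioi_mul_exp_integral_Ioi_le hg0 hg x) hc

/-- A Grönwall-type bound for bounded solutions of the Volterra equation. -/
lemma norm_le_of_volterra (hg0 : ∀ y, 0 ≤ g y) (hg : Integrable g)
    (hKb : ∀ x y : ℝ, x ≤ y → ‖K x y‖ ≤ g y)
    {f w : ℝ → ℂ} {F B : ℝ} (hf : ∀ x, ‖f x‖ ≤ F) (hB : ∀ x, ‖w x‖ ≤ B)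
    (hw : ∀ x, w x = f x + ∫ y in Ioi x, K x y * w y) (x : ℝ) :
    ‖w x‖ ≤ F * Real.exp (∫ t in Ioi x, g t) := by
  set p : ℝ → ℝ := fun x ↦ Real.exp (∫ t in Ioi x, g t)
  have hp0 : ∀ x, 0 < p x := fun x ↦ Real.exp_pos _
  have hp1 : ∀ x, 1 ≤ p x := fun x ↦ Real.one_le_exp (integral_Ioi_nonneg hg0 x)
  have hpG : ∀ x, p x ≤ Real.exp (∫ t, g t) := fun x ↦
    Real.exp_le_exp.2 (integral_Ioi_le_integral hg0 hg x)
  have hF : 0 ≤ F := (norm_nonneg _).trans (hf 0)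
  have hbdd : BddAbove (range fun x ↦ ‖w x‖ / p x) := by
    refine ⟨B, ?_⟩
    rintro _ ⟨y, rfl⟩
    exact (div_le_self (norm_nonneg _) (hp1 y)).trans (hB y)
  set c : ℝ := ⨆ x, ‖w x‖ / p x
  have hwc : ∀ y, ‖w y‖ ≤ c * p y := fun y ↦ (div_le_iff₀ (hp0 y)).1 (le_ciSup hbdd y)
  have hc0 : 0 ≤ c := Real.iSup_nonneg fun y ↦ div_nonneg (norm_nonneg _) (hp0 y).le
  have hstep : ∀ y, ‖w y‖ ≤ F + c * (p y - 1) := fun y ↦ by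
    rw [hw y]
    exact (norm_add_le _ _).trans
      (add_le_add (hf y) (norm_volterra_integral_le hg0 hg hKb hc0 hwc y))
  have hcF : c ≤ F := by
    by_contra! hlt
    have hle : c ≤ c - (c - F) / Real.exp (∫ t, g t) := by
      refine ciSup_le fun y ↦ ?_
      rw [div_le_iff₀ (hp0 y), sub_mul]
      have : (c - F) / Real.exp (∫ t, g t) * p y ≤ c - F := by
        rw [div_mul_eq_mul_div, div_le_iff₀ (Real.exp_pos _)]
        exact mul_le_mul_of_nonneg_left (hpG y) (sub_pos.2 hlt).le
      linarith [hstep y]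
    have : 0 < (c - F) / Real.exp (∫ t, g t) := div_pos (sub_pos.2 hlt) (Real.exp_pos _)
    linarith
  exact (hwc x).trans (mul_le_mul_of_nonneg_right hcF (hp0 x).le)

/-- Two bounded continuous solutions of the Volterra equation coincide. -/
lemma volterra_solution_unique (hg0 : ∀ y, 0 ≤ g y) (hg : Integrable g)
    (hKcont : Continuous (Function.uncurry K)) (hKb : ∀ x y : ℝ, x ≤ y → ‖K x y‖ ≤ g y)
    {f u v : ℝ → ℂ} (huc : Continuous u) (hvc : Continuous v) {B C : ℝ}
    (hB : ∀ x, ‖u x‖ ≤ B) (hC : ∀ x, ‖v x‖ ≤ C)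
    (hu : ∀ x, u x = f x + ∫ y in Ioi x, K x y * u y)
    (hv : ∀ x, v x = f x + ∫ y in Ioi x, K x y * v y) : u = v := by
  funext x
  have hle := norm_le_of_volterra (f := fun _ ↦ 0) (w := fun x ↦ u x - v x) (F := 0)
    (B := B + C) hg0 hg hKb (by simp)
    (fun x ↦ (norm_sub_le _ _).trans (add_le_add (hB x) (hC x)))
    (fun x ↦ by
      simp_rw [mul_sub]
      rw [integral_sub (integrableOn_volterra_integrand hg hKcont hKb huc hB x)
        (integrableOn_volterra_integrand hg hKcont hKb hvc hC x), hu x, hv x]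
      ring) x
  rw [zero_mul] at hle
  exact sub_eq_zero.1 (norm_le_zero_iff.1 hle)

/-- Existence of a bounded continuous solution of the Volterra equation, by the contraction
principle in the norm weighted by the exponential of the tail of `g`. -/
lemma exists_volterra_solution (hg0 : ∀ y, 0 ≤ g y) (hg : Integrable g)
    (hKcont : Continuous (Function.uncurry K)) (hKb : ∀ x y : ℝ, x ≤ y → ‖K x y‖ ≤ g y)
    (hK0 : ∀ x y : ℝ, y < x → K x y = 0)
    {f : ℝ → ℂ} (hfc : Continuous f) {F : ℝ} (hf : ∀ x, ‖f x‖ ≤ F) :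
    ∃ w : ℝ → ℂ, (Continuous w ∧ ∃ B : ℝ, ∀ x, ‖w x‖ ≤ B) ∧
      ∀ x, w x = f x + ∫ y in Ioi x, K x y * w y := by
  set p : ℝ → ℝ := fun x ↦ Real.exp (∫ t in Ioi x, g t)
  set A : ℝ := Real.exp (∫ t, g t)
  have hA0 : 0 < A := Real.exp_pos _
  have hA1 : 1 ≤ A := Real.one_le_exp (integral_nonneg hg0)
  have hp0 : ∀ x, 0 < p x := fun x ↦ Real.exp_pos _
  have hp1 : ∀ x, 1 ≤ p x := fun x ↦ Real.one_le_exp (integral_Ioi_nonneg hg0 x)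
  have hpA : ∀ x, p x ≤ A := fun x ↦
    Real.exp_le_exp.2 (integral_Ioi_le_integral hg0 hg x)
  have hpc : Continuous p := Real.continuous_exp.comp (continuous_integral_Ioi hg)
  have hpC : Continuous fun x ↦ (p x : ℂ) := continuous_ofReal.comp hpc
  have hwp : ∀ (v : ℝ →ᵇ ℂ) x, ‖(p x : ℂ) * v x‖ ≤ ‖v‖ * p x := fun v x ↦ by
    rw [norm_mul, norm_real, Real.norm_of_nonneg (hp0 x).le, mul_comm]
    exact mul_le_mul_of_nonneg_right (v.norm_coe_le_norm x) (hp0 x).le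
  have hwA : ∀ (v : ℝ →ᵇ ℂ) x, ‖(p x : ℂ) * v x‖ ≤ ‖v‖ * A := fun v x ↦
    (hwp v x).trans (mul_le_mul_of_nonneg_left (hpA x) (norm_nonneg v))
  have hwc : ∀ v : ℝ →ᵇ ℂ, Continuous fun x ↦ (p x : ℂ) * v x := fun v ↦ hpC.mul v.continuous
  have hdiv : ∀ (z : ℂ) x, ‖z / (p x : ℂ)‖ = ‖z‖ / p x := fun z x ↦ by
    rw [norm_div, norm_real, Real.norm_of_nonneg (hp0 x).le]
  let S : (ℝ →ᵇ ℂ) → (ℝ →ᵇ ℂ) := fun v ↦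
    BoundedContinuousFunction.ofNormedAddCommGroup
      (fun x ↦ (f x + ∫ y in Ioi x, K x y * ((p y : ℂ) * v y)) / (p x : ℂ))
      ((hfc.add (continuous_volterra_integral hg0 hg hKcont hKb hK0 (hwc v) (hwA v))).div hpC
        fun x ↦ ofReal_ne_zero.2 (hp0 x).ne')
      (F + ‖v‖ * (A - 1))
      (fun x ↦ by
        rw [hdiv]
        refine (div_le_self (norm_nonneg _) (hp1 x)).trans ((norm_add_le _ _).trans
          (add_le_add (hf x) ((norm_volterra_integral_le hg0 hg hKb (norm_nonneg v)
            (hwp v) x).trans ?_)))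
        exact mul_le_mul_of_nonneg_left (sub_le_sub_right (hpA x) 1) (norm_nonneg v))
  have hSapply : ∀ v x, S v x =
      (f x + ∫ y in Ioi x, K x y * ((p y : ℂ) * v y)) / (p x : ℂ) := fun _ _ ↦ rfl
  have hk0 : 0 ≤ 1 - 1 / A := sub_nonneg.2 ((div_le_one hA0).2 hA1)
  have hS : ContractingWith (NNReal.mk (1 - 1 / A) hk0) S := by
    refine ⟨?_, LipschitzWith.of_dist_le_mul fun u v ↦ ?_⟩
    · rw [← NNReal.coe_lt_coe]
      exact sub_lt_self 1 (div_pos one_pos hA0)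
    refine (BoundedContinuousFunction.dist_le (mul_nonneg hk0 dist_nonneg)).2 fun x ↦ ?_
    have hsub : S u x - S v x =
        (∫ y in Ioi x, K x y * ((p y : ℂ) * (u - v) y)) / (p x : ℂ) := by
      simp_rw [hSapply, BoundedContinuousFunction.sub_apply, mul_sub]
      rw [integral_sub (integrableOn_volterra_integrand hg hKcont hKb (hwc u) (hwA u) x)
        (integrableOn_volterra_integrand hg hKcont hKb (hwc v) (hwA v) x)]
      ring
    rw [dist_eq_norm, hsub, hdiv, dist_eq_norm, div_le_iff₀ (hp0 x)]
    refine (norm_volterra_integral_le hg0 hg hKb (norm_nonneg _) (hwp (u - v)) x).trans ?_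
    have hpx : 1 / A * p x ≤ 1 := by
      rw [div_mul_eq_mul_div, one_mul]
      exact (div_le_one hA0).2 (hpA x)
    calc ‖u - v‖ * (p x - 1) ≤ ‖u - v‖ * (p x - 1 / A * p x) :=
          mul_le_mul_of_nonneg_left (by linarith) (norm_nonneg _)
      _ = (1 - 1 / A) * ‖u - v‖ * p x := by ring
  have : Nonempty (ℝ →ᵇ ℂ) := ⟨0⟩
  obtain ⟨v, hv⟩ : ∃ v, S v = v := ⟨_, hS.fixedPoint_isFixedPt⟩
  refine ⟨fun x ↦ (p x : ℂ) * v x, ⟨hwc v, ‖v‖ * A, hwA v⟩, fun x ↦ ?_⟩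
  have hvx := hSapply v x
  rw [hv, eq_div_iff (ofReal_ne_zero.2 (hp0 x).ne')] at hvx
  rw [← hvx, mul_comm]

end Volterra

/-- Solvability of the Volterra integral equation `μ(x) = f(x) + ∫_x^∞ K(x,y) μ(y) dy`:
if `|K(x,y)| ≤ g(y)` for `x ≤ y` with `g ≥ 0` integrable with `∫ g = G`, `K` continuous and
vanishing for `y < x`, then for every bounded continuous `f` there is a unique bounded
continuous solution `μ`, and it satisfies `sup |μ| ≤ e^G sup |f|`. -/
theorem volterra_equation_solvable (g : ℝ → ℝ) (hg0 : ∀ y : ℝ, 0 ≤ g y)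
    (hg : Integrable g) (G : ℝ) (hG : (∫ y : ℝ, g y) = G)
    (K : ℝ → ℝ → ℂ) (hKcont : Continuous (Function.uncurry K))
    (hKb : ∀ x y : ℝ, x ≤ y → ‖K x y‖ ≤ g y)
    (hK0 : ∀ x y : ℝ, y < x → K x y = 0)
    (f : ℝ → ℂ) (hfc : Continuous f) (hfb : ∃ B : ℝ, ∀ x : ℝ, ‖f x‖ ≤ B) :
    ∃ μ : ℝ → ℂ,
      ((Continuous μ ∧ ∃ B : ℝ, ∀ x : ℝ, ‖μ x‖ ≤ B) ∧
        (∀ x : ℝ, μ x = f x + ∫ y in Set.Ioi x, K x y * μ y)) ∧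
      (∀ x : ℝ, ‖μ x‖ ≤ Real.exp G * ⨆ x' : ℝ, ‖f x'‖) ∧
      (∀ μ' : ℝ → ℂ,
        (Continuous μ' ∧ ∃ B : ℝ, ∀ x : ℝ, ‖μ' x‖ ≤ B) →
        (∀ x : ℝ, μ' x = f x + ∫ y in Set.Ioi x, K x y * μ' y) →
        μ' = μ) := by
  obtain ⟨B, hB⟩ := hfb
  obtain ⟨μ, ⟨hμc, C, hC⟩, hμ⟩ := exists_volterra_solution hg0 hg hKcont hKb hK0 hfc hB
  have hfsup : ∀ x, ‖f x‖ ≤ ⨆ x' : ℝ, ‖f x'‖ :=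
    le_ciSup ⟨B, by rintro _ ⟨y, rfl⟩; exact hB y⟩
  refine ⟨μ, ⟨⟨hμc, C, hC⟩, hμ⟩, fun x ↦ ?_, fun μ' hμ' hsol ↦ ?_⟩
  · refine (norm_le_of_volterra hg0 hg hKb hfsup hC hμ x).trans ?_
    rw [mul_comm, ← hG]
    exact mul_le_mul_of_nonneg_right
      (Real.exp_le_exp.2 (integral_Ioi_le_integral hg0 hg x))
      (Real.iSup_nonneg fun _ ↦ norm_nonneg _)
  · obtain ⟨hμ'c, D, hD⟩ := hμ'
    exact volterra_solution_unique hg0 hg hKcont hKb hμ'c hμc hD hC hsol hμ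
end

section
/- Let p : ℝ → ℝ be continuously differentiable with p′(y) ≥ 1 for all y, and let f : ℝ → ℂ be integrable with ∫₀^∞ y |f(y)|² dy < ∞. Then ∫₀^∞ ∫_ℝ | ∫_x^∞ f(y) e^{2 i η ( p(x) − p(y) )} dy |² dη dx ≤ π ∫₀^∞ y |f(y)|² dy. -/
open Complex MeasureTheory
open scoped FourierTransform SchwartzMap ContDiff

/-- On `L¹ ∩ L²` the `L²` Fourier transform agrees almost everywhere with the Fourier integral. -/
theorem Lp_ae_eq_fourier {V F : Type*} [NormedAddCommGroup V] [InnerProductSpace ℝ V]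
    [FiniteDimensional ℝ V] [MeasurableSpace V] [BorelSpace V] [NormedAddCommGroup F]
    [InnerProductSpace ℂ F] [CompleteSpace F] {f : V → F} (hf : Integrable f)
    {g G : Lp F 2 (volume : Measure V)} (hfg : g =ᵐ[volume] f) (hG : 𝓕 g = G) :
    G =ᵐ[volume] 𝓕 f := by
  have hcont : Continuous (𝓕 f) :=
    VectorFourier.fourierIntegral_continuous Real.continuous_fourierChar
      (by exact continuous_inner) hf
  have hdist : 𝓕 (g : 𝓢'(V, F)) = (G : 𝓢'(V, F)) := by
    rw [Lp.fourier_toTemperedDistribution_eq, hG]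
  refine ae_eq_of_integral_contDiff_smul_eq ((Lp.memLp G).locallyIntegrable one_le_two)
    hcont.locallyIntegrable fun φ hφ hφc => ?_
  have hφ₁ : HasCompactSupport (Complex.ofRealCLM ∘ φ) := hφc.comp_left rfl
  have hφ₂ : ContDiff ℝ ∞ (Complex.ofRealCLM ∘ φ) := by fun_prop
  let ψ : 𝓢(V, ℂ) := hφ₁.toSchwartzMap hφ₂
  have hψ : ∀ x, ψ x = (φ x : ℂ) := fun x => rfl
  have h := congrArg (fun T : 𝓢'(V, F) => T ψ) hdist
  simp only [TemperedDistribution.fourier_apply, Lp.toTemperedDistribution_apply] at h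
  have hcongr : ∫ x, (𝓕 ψ) x • g x = ∫ x, (𝓕 ψ) x • f x := by
    refine integral_congr_ae ?_
    filter_upwards [hfg] with x hx
    rw [hx]
  have hswap : ∫ x, (𝓕 ψ) x • f x = ∫ x, ψ x • 𝓕 f x := by
    simpa [SchwartzMap.fourier_coe] using! VectorFourier.integral_fourierIntegral_smul_eq_flip
      (L := innerₗ V) Real.continuous_fourierChar continuous_inner ψ.integrable hf
  rw [hcongr, hswap] at h
  simpa [hψ] using h.symm

/-- Plancherel's theorem for the Fourier integral of a function in `L¹ ∩ L²`. -/
theorem integral_norm_sq_fourier {V F : Type*} [NormedAddCommGroup V] [InnerProductSpace ℝ V]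
    [FiniteDimensional ℝ V] [MeasurableSpace V] [BorelSpace V] [NormedAddCommGroup F]
    [InnerProductSpace ℂ F] [CompleteSpace F] {f : V → F} (hf : Integrable f)
    (hf2 : MemLp f 2) : ∫ w, ‖𝓕 f w‖ ^ 2 = ∫ v, ‖f v‖ ^ 2 := by
  have key : ∀ {h : Lp F 2 (volume : Measure V)} {k : V → F}, h =ᵐ[volume] k →
      ∫ x, ‖k x‖ ^ 2 = ‖h‖ ^ 2 := fun {h k} hk => by
    have hcongr : ∫ x, ‖k x‖ ^ 2 = ∫ x, ‖h x‖ ^ 2 := by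
      refine integral_congr_ae ?_
      filter_upwards [hk] with x hx
      rw [hx]
    rw [hcongr, ← Complex.ofReal_inj, ← integral_complex_ofReal]
    push_cast
    refine Eq.trans ?_ (inner_self_eq_norm_sq_to_K (𝕜 := ℂ) h)
    rw [L2.inner_def]
    simp [inner_self_eq_norm_sq_to_K]
  rw [key (Lp_ae_eq_fourier hf hf2.coeFn_toLp rfl), key hf2.coeFn_toLp, Lp.norm_fourier_eq]

/-- Plancherel's theorem after a change of variable `u = p y` with `p' ≥ 1`. -/
theorem integral_norm_sq_setIntegral_exp_le {p p' : ℝ → ℝ} {s : Set ℝ} (hs : MeasurableSet s)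
    (hp : ∀ y ∈ s, HasDerivWithinAt p (p' y) s y) (hinj : Set.InjOn p s)
    (hp' : ∀ y ∈ s, 1 ≤ p' y) {f : ℝ → ℂ} (hf : IntegrableOn f s)
    (hf2 : IntegrableOn (fun y => ‖f y‖ ^ 2) s) :
    ∫ η : ℝ, ‖∫ y in s, f y * Complex.exp (-(2 * Complex.I * η * p y))‖ ^ 2 ≤
      Real.pi * ∫ y in s, ‖f y‖ ^ 2 := by
  let k : ℝ → ℂ := fun u => f (Function.invFunOn p s u) / p' (Function.invFunOn p s u)
  have hk : ∀ y ∈ s, k (p y) = f y / p' y := fun y hy => by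
    simp only [k, hinj.leftInvOn_invFunOn hy]
  have hpos : ∀ y ∈ s, 0 < p' y := fun y hy => one_pos.trans_le (hp' y hy)
  have hms : MeasurableSet (p '' s) :=
    hs.image_of_continuousOn_injOn (fun y hy => (hp y hy).continuousWithinAt) hinj
  have hkint : IntegrableOn k (p '' s) := by
    rw [integrableOn_image_iff_integrableOn_abs_deriv_smul hs hp hinj]
    refine hf.congr_fun (fun y hy => ?_) hs
    have : (p' y : ℂ) ≠ 0 := by exact_mod_cast (hpos y hy).ne'
    simp only [hk y hy, abs_of_pos (hpos y hy), real_smul]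
    field_simp
  have hsq : ∀ y ∈ s, |p' y| • ‖k (p y)‖ ^ 2 = (p' y)⁻¹ * ‖f y‖ ^ 2 := fun y hy => by
    have := (hpos y hy).ne'
    rw [hk y hy, abs_of_pos (hpos y hy), norm_div, norm_real, Real.norm_eq_abs,
      abs_of_pos (hpos y hy), smul_eq_mul]
    field_simp
  have hle : ∀ y ∈ s, (p' y)⁻¹ * ‖f y‖ ^ 2 ≤ ‖f y‖ ^ 2 := fun y hy =>
    mul_le_of_le_one_left (sq_nonneg _) (inv_le_one_of_one_le₀ (hp' y hy))
  have hp'm : AEMeasurable p' (volume.restrict s) := by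
    simpa using (aemeasurable_fderivWithin volume hs
      fun y hy => (hp y hy).hasFDerivWithinAt).apply_continuousLinearMap (1 : ℝ)
  have hm : AEStronglyMeasurable (fun y => (p' y)⁻¹ * ‖f y‖ ^ 2) (volume.restrict s) :=
    (hp'm.inv.mul hf2.aemeasurable).aestronglyMeasurable
  have hint : IntegrableOn (fun y => (p' y)⁻¹ * ‖f y‖ ^ 2) s := by
    refine Integrable.mono' hf2 hm ?_
    refine (ae_restrict_mem hs).mono fun y hy => ?_
    have := hpos y hy
    rw [Real.norm_of_nonneg (by positivity)]
    exact hle y hy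
  have hk2 : IntegrableOn (fun u => ‖k u‖ ^ 2) (p '' s) := by
    rw [integrableOn_image_iff_integrableOn_abs_deriv_smul hs hp hinj]
    exact hint.congr_fun (fun y hy => (hsq y hy).symm) hs
  let g : ℝ → ℂ := (p '' s).indicator k
  have hg : Integrable g := (integrable_indicator_iff hms).2 hkint
  have hg2 : MemLp g 2 :=
    (memLp_indicator_iff_restrict hms).2
      ((memLp_two_iff_integrable_sq_norm hkint.aestronglyMeasurable).2 hk2)
  have hF : ∀ η : ℝ, ∫ y in s, f y * Complex.exp (-(2 * Complex.I * η * p y)) =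
      𝓕 g (η / Real.pi) := fun η => by
    have hind : (fun v => Complex.exp (↑(-2 * Real.pi * v * (η / Real.pi)) * Complex.I) • g v) =
        (p '' s).indicator
          (fun v => Complex.exp (↑(-2 * Real.pi * v * (η / Real.pi)) * Complex.I) • k v) := by
      ext v
      by_cases hv : v ∈ p '' s <;> simp [g, hv]
    rw [Real.fourier_real_eq_integral_exp_smul, hind, integral_indicator hms,
      integral_image_eq_integral_abs_deriv_smul hs hp hinj]
    refine setIntegral_congr_fun hs fun y hy => ?_
    have h0 : (p' y : ℂ) ≠ 0 := by exact_mod_cast (hpos y hy).ne'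
    have hexp : (↑(-2 * Real.pi * p y * (η / Real.pi)) * Complex.I : ℂ) =
        -(2 * Complex.I * η * p y) := by
      have : (Real.pi : ℂ) ≠ 0 := by exact_mod_cast Real.pi_ne_zero
      push_cast
      field_simp
    simp only [hexp, hk y hy, abs_of_pos (hpos y hy), real_smul, smul_eq_mul]
    field_simp
  have hnorm : ∫ u, ‖g u‖ ^ 2 = ∫ y in s, (p' y)⁻¹ * ‖f y‖ ^ 2 := by
    have hind : (fun u => ‖g u‖ ^ 2) = (p '' s).indicator (fun u => ‖k u‖ ^ 2) := by
      ext u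
      by_cases hu : u ∈ p '' s <;> simp [g, hu]
    rw [hind, integral_indicator hms, integral_image_eq_integral_abs_deriv_smul hs hp hinj]
    exact setIntegral_congr_fun hs hsq
  simp_rw [hF]
  rw [Measure.integral_comp_div (fun ξ => ‖𝓕 g ξ‖ ^ 2), integral_norm_sq_fourier hg hg2, hnorm,
    abs_of_pos Real.pi_pos, smul_eq_mul]
  exact mul_le_mul_of_nonneg_left (setIntegral_mono_on hint hf2 hs hle) Real.pi_pos.le

/-- Tonelli's theorem for the tails of an integral over `(0, ∞)`. -/
theorem integrableOn_setIntegral_Ioi {h : ℝ → ℝ} (hh : AEStronglyMeasurable h)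
    (hw : IntegrableOn (fun y => y * h y) (Set.Ioi 0)) :
    IntegrableOn (fun x => ∫ y in Set.Ioi x, h y) (Set.Ioi 0) ∧
      ∫ x in Set.Ioi (0 : ℝ), ∫ y in Set.Ioi x, h y = ∫ y in Set.Ioi (0 : ℝ), y * h y := by
  let μ : Measure ℝ := volume.restrict (Set.Ioi 0)
  let T : Set (ℝ × ℝ) := {z | z.1 < z.2}
  have hT : MeasurableSet T := measurableSet_lt measurable_fst measurable_snd
  let H : ℝ × ℝ → ℝ := T.indicator fun z => h z.2
  have hHm : AEStronglyMeasurable H (μ.prod μ) := (hh.restrict.comp_snd).indicator hT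
  have hvol : ∀ y : ℝ, 0 < y → μ.real (Set.Iio y) = y := fun y hy => by
    simp [μ, measureReal_restrict_apply, Set.Iio_inter_Ioi, hy.le]
  have hsec : ∀ y, (fun x => H (x, y)) = (Set.Iio y).indicator fun _ => h y := fun y => rfl
  have hint : Integrable H (μ.prod μ) := by
    rw [integrable_prod_iff' hHm]
    constructor
    · refine (ae_restrict_mem measurableSet_Ioi).mono fun y hy => ?_
      rw [hsec, integrable_indicator_iff measurableSet_Iio]
      refine integrableOn_const ?_
      simp [μ, Measure.restrict_apply, Set.Iio_inter_Ioi]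
    · refine hw.norm.congr ((ae_restrict_mem measurableSet_Ioi).mono fun y hy => ?_)
      have : (fun x => ‖H (x, y)‖) = (Set.Iio y).indicator fun _ => ‖h y‖ := by
        ext x
        exact norm_indicator_eq_indicator_norm (f := fun z : ℝ × ℝ => h z.2) (s := T) (x, y)
      beta_reduce
      rw [this, integral_indicator measurableSet_Iio, setIntegral_const, hvol y hy, norm_mul,
        Real.norm_of_nonneg (le_of_lt hy), smul_eq_mul]
  have hinner : ∀ x ∈ Set.Ioi (0 : ℝ), ∫ y, H (x, y) ∂μ = ∫ y in Set.Ioi x, h y := fun x hx => by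
    have : (fun y => H (x, y)) = (Set.Ioi x).indicator h := rfl
    rw [this, integral_indicator measurableSet_Ioi, Measure.restrict_restrict measurableSet_Ioi,
      Set.inter_eq_left.2 (Set.Ioi_subset_Ioi (le_of_lt hx))]
  refine ⟨IntegrableOn.congr_fun hint.integral_prod_left hinner measurableSet_Ioi, ?_⟩
  rw [← setIntegral_congr_fun measurableSet_Ioi hinner]
  refine (integral_integral_swap (f := fun x y => H (x, y)) hint).trans ?_
  refine setIntegral_congr_fun measurableSet_Ioi fun y hy => ?_
  simp only [hsec]
  rw [integral_indicator measurableSet_Iio, setIntegral_const, hvol y hy, smul_eq_mul]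

/-- Plancherel-type estimate through the change of variables `u = p(y)` with `p′ ≥ 1`:
for integrable `f` with `∫₀^∞ y|f(y)|² dy < ∞`,
`∫₀^∞ ∫_ℝ |∫_x^∞ f(y) e^{2iη(p(x)−p(y))} dy|² dη dx ≤ π ∫₀^∞ y|f(y)|² dy`. -/
theorem volterra_plancherel_estimate (p : ℝ → ℝ) (hp : ContDiff ℝ 1 p)
    (hp' : ∀ y : ℝ, 1 ≤ deriv p y)
    (f : ℝ → ℂ) (hf : Integrable f)
    (hfw : IntegrableOn (fun y : ℝ => y * ‖f y‖ ^ 2) (Set.Ioi 0)) :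
    (∫ x in Set.Ioi (0 : ℝ), ∫ η : ℝ,
        ‖∫ y in Set.Ioi x,
            f y * Complex.exp (2 * Complex.I * (η : ℂ) * ((p x : ℂ) - (p y : ℂ)))‖ ^ 2) ≤
      Real.pi * ∫ y in Set.Ioi (0 : ℝ), y * ‖f y‖ ^ 2 := by
  have hinj : Function.Injective p :=
    (strictMono_of_deriv_pos fun y => one_pos.trans_le (hp' y)).injective
  have hderiv : ∀ y, HasDerivAt p (deriv p y) y := fun y =>
    (hp.differentiable one_ne_zero y).hasDerivAt
  have hm : AEStronglyMeasurable fun y => ‖f y‖ ^ 2 := hf.aestronglyMeasurable.norm.pow 2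
  obtain ⟨htail, hswap⟩ := integrableOn_setIntegral_Ioi hm hfw
  rw [← hswap, ← integral_const_mul]
  refine integral_mono_of_nonneg
    (Filter.Eventually.of_forall fun x => integral_nonneg fun η => sq_nonneg _)
    (htail.const_mul _) ((ae_restrict_mem measurableSet_Ioi).mono fun x hx => ?_)
  have hx : 0 < x := hx
  have hf2 : IntegrableOn (fun y => ‖f y‖ ^ 2) (Set.Ioi x) := by
    refine Integrable.mono' ((hfw.mono_set (Set.Ioi_subset_Ioi hx.le)).const_mul x⁻¹) hm.restrict
      ((ae_restrict_mem measurableSet_Ioi).mono fun y hy => ?_)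
    have hy : x < y := hy
    rw [Real.norm_of_nonneg (sq_nonneg _), ← mul_assoc]
    refine le_mul_of_one_le_left (sq_nonneg _) ?_
    rw [inv_mul_eq_div, one_le_div hx]
    exact hy.le
  refine le_trans (le_of_eq ?_) (integral_norm_sq_setIntegral_exp_le measurableSet_Ioi
    (fun y _ => (hderiv y).hasDerivWithinAt) hinj.injOn (fun y _ => hp' y) hf.integrableOn hf2)
  refine integral_congr_ae (Filter.Eventually.of_forall fun η => ?_)
  have hphase : ∀ y, f y * Complex.exp (2 * Complex.I * η * ((p x : ℂ) - p y)) =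
      Complex.exp (↑(2 * η * p x) * Complex.I) *
        (f y * Complex.exp (-(2 * Complex.I * η * p y))) := fun y => by
    rw [mul_left_comm, ← Complex.exp_add]
    congr 2
    push_cast
    ring
  simp only [hphase]
  rw [integral_const_mul, norm_mul, Complex.norm_exp_ofReal_mul_I, one_mul]
end
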